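/- arXiv:2109.04989 — 6 statements merged into one kernel-verified Lean document; each statement's English description precedes it below -/
import Mathlib

section
/- For every ballot sequence w of length 2n there exists a noncrossing perfect matching M of Fin (2n) such that every pair {i, j} of M with i < j satisfies w i = true and w j = false, and this noncrossing perfect matching is unique. -/
def IsBallot (n : ℕ) (w : Fin (2 * n) → Bool) : Prop :=
  (Finset.univ.filter fun i => w i = true).card = n ∧
    ∀ m : ℕ, m ≤ 2 * n →
      (Finset.univ.filter fun i : Fin (2 * n) => i.val < m ∧ w i = true).card ≥
        (Finset.univ.filter fun i : Fin (2 * n) => i.val < m ∧ w i = false).card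

def IsPerfectMatching (n : ℕ) (M : Finset (Finset (Fin (2 * n)))) : Prop :=
  (∀ p ∈ M, p.card = 2) ∧ ∀ i : Fin (2 * n), ∃! p, p ∈ M ∧ i ∈ p

def IsNoncrossing (n : ℕ) (M : Finset (Finset (Fin (2 * n)))) : Prop :=
  ¬ ∃ i k j l : Fin (2 * n), i < k ∧ k < j ∧ j < l ∧
      ({i, j} : Finset (Fin (2 * n))) ∈ M ∧ ({k, l} : Finset (Fin (2 * n))) ∈ M

/-- The height of the lattice path of `w` after `m` steps, with an up-step for each `true`
and a down-step for each `false`. -/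
def pathHeight {N : ℕ} (w : Fin N → Bool) (m : ℕ) : ℤ :=
  ∑ i : Fin N, if i.val < m then (if w i = true then 1 else -1) else 0

/-- Positions `i < j` form an arc when the path first returns to its height before `i`
right after step `j`. -/
def IsArc {N : ℕ} (w : Fin N → Bool) (i j : Fin N) : Prop :=
  i < j ∧ pathHeight w (j + 1) = pathHeight w i ∧
    ∀ k : ℕ, i.val < k → k ≤ j.val → pathHeight w i < pathHeight w k

section Height

variable {N : ℕ} (w : Fin N → Bool)

lemma pathHeight_zero : pathHeight w 0 = 0 := by
  simp [pathHeight]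

lemma pathHeight_succ (i : Fin N) :
    pathHeight w (i + 1) = pathHeight w i + if w i = true then 1 else -1 := by
  have h : (if w i = true then (1 : ℤ) else -1) =
      ∑ k : Fin N, if k = i then (if w k = true then 1 else -1) else 0 := by
    simp
  rw [h, pathHeight, pathHeight, ← Finset.sum_add_distrib]
  refine Finset.sum_congr rfl fun k _ => ?_
  rcases lt_trichotomy k i with hk | rfl | hk
  · have : k.val < i.val := hk
    simp [this, hk.ne, Nat.lt_succ_of_lt this]
  · simp
  · have : i.val < k.val := hk
    have h1 : ¬ k.val < i.val := by omega
    have h2 : ¬ k.val < i.val + 1 := by omega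
    simp [h1, h2, hk.ne']

lemma pathHeight_eq_card_sub_card (m : ℕ) :
    pathHeight w m =
      ((Finset.univ.filter fun i : Fin N => i.val < m ∧ w i = true).card : ℤ) -
        (Finset.univ.filter fun i : Fin N => i.val < m ∧ w i = false).card := by
  rw [Finset.card_filter, Finset.card_filter]
  push_cast
  rw [← Finset.sum_sub_distrib, pathHeight]
  refine Finset.sum_congr rfl fun i _ => ?_
  by_cases h : i.val < m <;> cases hi : w i <;> simp [h]

variable {w}

lemma pathHeight_succ_of_true {i : Fin N} (h : w i = true) :
    pathHeight w (i + 1) = pathHeight w i + 1 := by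
  simp [pathHeight_succ, h]

lemma pathHeight_succ_of_false {i : Fin N} (h : w i = false) :
    pathHeight w (i + 1) = pathHeight w i - 1 := by
  simp [pathHeight_succ, h, sub_eq_add_neg]

lemma IsArc.apply_left {i j : Fin N} (h : IsArc w i j) : w i = true := by
  obtain ⟨hij, -, hk⟩ := h
  have := hk (i + 1) (by omega) hij
  by_contra hw
  rw [pathHeight_succ_of_false (by simpa using hw)] at this
  omega

lemma IsArc.apply_right {i j : Fin N} (h : IsArc w i j) : w j = false := by
  obtain ⟨hij, he, hk⟩ := h
  have := hk j hij le_rfl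
  by_contra hw
  rw [pathHeight_succ_of_true (by simpa using hw)] at he
  omega

lemma IsArc.right_unique {i j j' : Fin N} (h : IsArc w i j) (h' : IsArc w i j') : j = j' := by
  obtain ⟨hij, he, hk⟩ := h
  obtain ⟨hij', he', hk'⟩ := h'
  rcases lt_trichotomy j j' with hj | hj | hj
  · have := hk' (j + 1) (by omega) (by omega)
    omega
  · exact hj
  · have := hk (j' + 1) (by omega) (by omega)
    omega

lemma IsArc.left_unique {i i' j : Fin N} (h : IsArc w i j) (h' : IsArc w i' j) : i = i' := by
  obtain ⟨hij, he, hk⟩ := h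
  obtain ⟨hij', he', hk'⟩ := h'
  rcases lt_trichotomy i i' with hi | hi | hi
  · have := hk i' hi (by omega)
    omega
  · exact hi
  · have := hk' i hi (by omega)
    omega

lemma IsArc.not_crossing {i k j l : Fin N} (h : IsArc w i j) (h' : IsArc w k l)
    (hik : i < k) (hkj : k < j) (hjl : j < l) : False := by
  have h1 := h.2.2 k hik hkj.le
  have h2 := h'.2.2 (j + 1) (by omega) (by omega)
  have h3 := h.2.1
  omega

lemma exists_isArc_left {i : Fin N} (hi : w i = true)
    (hend : pathHeight w N ≤ pathHeight w i) : ∃ j, IsArc w i j := by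
  classical
  have hex : ∃ k : ℕ, i.val < k ∧ pathHeight w k ≤ pathHeight w i := ⟨N, i.2, hend⟩
  obtain ⟨hik, hle⟩ := Nat.find_spec hex
  have hmin := fun m => Nat.find_min hex (m := m)
  have hN : Nat.find hex ≤ N := Nat.find_min' hex ⟨i.2, hend⟩
  generalize Nat.find hex = k at *
  obtain ⟨j, rfl⟩ : ∃ j, k = j + 1 := ⟨k - 1, by omega⟩
  have hup := pathHeight_succ_of_true hi
  have hne : j ≠ i := by
    rintro rfl
    omega
  have habove : ∀ m : ℕ, i.val < m → m ≤ j → pathHeight w i < pathHeight w m :=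
    fun m h1 h2 => not_le.1 fun h => hmin m (by omega) ⟨h1, h⟩
  have hstep := pathHeight_succ w ⟨j, hN⟩
  have hj := habove j (by omega) le_rfl
  refine ⟨⟨j, hN⟩, Fin.lt_def.2 (by simp only; omega), ?_, habove⟩
  simp only at hstep ⊢
  split_ifs at hstep <;> omega

lemma exists_isArc_right {j : Fin N} (hj : w j = false)
    (hstart : 0 ≤ pathHeight w (j + 1)) : ∃ i, IsArc w i j := by
  classical
  let P : ℕ → Prop := fun k => pathHeight w k ≤ pathHeight w (j + 1)
  have hP0 : P 0 := by simpa [P, pathHeight_zero] using hstart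
  have hle : Nat.findGreatest P j ≤ j := Nat.findGreatest_le _
  have hspec : P (Nat.findGreatest P j) := Nat.findGreatest_spec (Nat.zero_le _) hP0
  have hmax : ∀ k, Nat.findGreatest P j < k → k ≤ j.val → ¬ P k :=
    fun k h1 h2 => Nat.findGreatest_is_greatest h1 h2
  generalize Nat.findGreatest P j = i at *
  simp only [P, not_le] at hspec hmax
  have hdown := pathHeight_succ_of_false hj
  have hne : i ≠ j := by
    rintro rfl
    omega
  have hiN : i < N := by omega
  have hstep := pathHeight_succ w ⟨i, hiN⟩
  have hi := hmax (i + 1) (by omega) (by omega)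
  have heq : pathHeight w (j + 1) = pathHeight w i := by
    simp only at hstep
    split_ifs at hstep <;> omega
  exact ⟨⟨i, hiN⟩, Fin.lt_def.2 (by simp only; omega), heq,
    fun k h1 h2 => heq ▸ hmax k h1 h2⟩

end Height

section Matching

variable {n : ℕ} {w : Fin (2 * n) → Bool}

lemma IsBallot.pathHeight_nonneg (hw : IsBallot n w) {m : ℕ} (hm : m ≤ 2 * n) :
    0 ≤ pathHeight w m := by
  have := hw.2 m hm
  rw [pathHeight_eq_card_sub_card]
  omega

lemma IsBallot.pathHeight_end (hw : IsBallot n w) : pathHeight w (2 * n) = 0 := by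
  have h := Finset.card_filter_add_card_filter_not (s := Finset.univ)
    (fun i : Fin (2 * n) => w i = true)
  have h1 := hw.1
  simp only [Finset.card_univ, Fintype.card_fin, Bool.not_eq_true] at h
  simp only [pathHeight_eq_card_sub_card, Fin.is_lt, true_and]
  omega

lemma IsPerfectMatching.exists_pair_mem {M : Finset (Finset (Fin (2 * n)))}
    (hM : IsPerfectMatching n M) (i : Fin (2 * n)) : ∃ j, i ≠ j ∧ {i, j} ∈ M := by
  obtain ⟨p, ⟨hp, hip⟩, -⟩ := hM.2 i
  obtain ⟨a, b, hab, rfl⟩ := Finset.card_eq_two.1 (hM.1 p hp)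
  rcases Finset.mem_insert.1 hip with rfl | h
  · exact ⟨b, hab, hp⟩
  · obtain rfl := Finset.mem_singleton.1 h
    exact ⟨a, hab.symm, Finset.pair_comm a i ▸ hp⟩

lemma IsPerfectMatching.partner_unique {M : Finset (Finset (Fin (2 * n)))}
    (hM : IsPerfectMatching n M) {i a b : Fin (2 * n)}
    (ha : {i, a} ∈ M) (hb : {i, b} ∈ M) : a = b := by
  have hab := (hM.2 i).unique ⟨ha, by simp⟩ ⟨hb, by simp⟩
  have h1 : a ∈ ({i, b} : Finset _) := hab ▸ by simp
  have h2 : b ∈ ({i, a} : Finset _) := hab ▸ by simp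
  simp only [Finset.mem_insert, Finset.mem_singleton] at h1 h2
  rcases h1 with rfl | h1
  · rcases h2 with h2 | h2 <;> exact h2.symm
  · exact h1

lemma IsPerfectMatching.eq_of_subset {M M' : Finset (Finset (Fin (2 * n)))}
    (hM : IsPerfectMatching n M) (hM' : IsPerfectMatching n M') (h : M ⊆ M') : M = M' := by
  refine h.antisymm fun p hp => ?_
  obtain ⟨i, hi⟩ : p.Nonempty := Finset.card_pos.1 (by rw [hM'.1 p hp]; norm_num)
  obtain ⟨q, ⟨hq, hiq⟩, -⟩ := hM.2 i
  rwa [(hM'.2 i).unique ⟨hp, hi⟩ ⟨h hq, hiq⟩]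

/-- In a noncrossing perfect matching whose pairs open at `true` and close at `false`,
every pair is an arc of the lattice path. -/
lemma isArc_of_pair_mem {M : Finset (Finset (Fin (2 * n)))}
    (hM : IsPerfectMatching n M) (hnc : IsNoncrossing n M)
    (hlab : ∀ i j : Fin (2 * n), i < j → ({i, j} : Finset (Fin (2 * n))) ∈ M →
      w i = true ∧ w j = false)
    {i j : Fin (2 * n)} (hij : i < j) (hmem : {i, j} ∈ M) : IsArc w i j := by
  induction hd : j.val - i.val using Nat.strong_induction_on generalizing i j with
  | _ d ih =>
  subst hd
  obtain ⟨hi, hj⟩ := hlab i j hij hmem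
  have hup := pathHeight_succ_of_true hi
  have hdown := pathHeight_succ_of_false hj
  have hclose : ∀ k : Fin (2 * n), i < k → k < j → w k = false →
      ∃ a, i < a ∧ a < k ∧ pathHeight w (k + 1) = pathHeight w a := by
    intro k hik hkj hk
    obtain ⟨a, hka, ha⟩ := hM.exists_pair_mem k
    have hak : a < k := by
      refine (lt_or_gt_of_ne hka).resolve_left fun h => ?_
      simpa [hk] using (hlab k a h ha).1
    rw [Finset.pair_comm] at ha
    have hia : i < a := by
      rcases lt_trichotomy i a with h | rfl | h
      · exact h
      · exact absurd (hM.partner_unique ha hmem) hkj.ne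
      · exact absurd ⟨a, i, k, j, h, hik, hkj, ha, hmem⟩ hnc
    exact ⟨a, hia, hak, (ih _ (by omega) hak ha rfl).2.1⟩
  have hopen : ∀ k : Fin (2 * n), i < k → k < j → w k = true →
      ∃ b, k < b ∧ b < j ∧ pathHeight w (b + 1) = pathHeight w k := by
    intro k hik hkj hk
    obtain ⟨b, hne, hb⟩ := hM.exists_pair_mem k
    have hkb : k < b := by
      refine (lt_or_gt_of_ne hne).resolve_right fun h => ?_
      rw [Finset.pair_comm] at hb
      simpa [hk] using (hlab b k h hb).2
    have hbj : b < j := by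
      rcases lt_trichotomy b j with h | rfl | h
      · exact h
      · rw [Finset.pair_comm] at hb hmem
        exact absurd (hM.partner_unique hmem hb) hik.ne
      · exact absurd ⟨i, k, j, b, hik, hkj, h, hmem, hb⟩ hnc
    exact ⟨b, hkb, hbj, (ih _ (by omega) hkb hb rfl).2.1⟩
  have habove : ∀ k : ℕ, i.val < k → k ≤ j.val → pathHeight w i < pathHeight w k := by
    intro k
    induction k using Nat.strong_induction_on with
    | _ k ihk =>
    intro hik hkj
    obtain ⟨k, rfl⟩ : ∃ m, k = m + 1 := ⟨k - 1, by omega⟩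
    rcases (Nat.lt_succ_iff.1 hik).eq_or_lt with rfl | hik'
    · omega
    have hkN : k < 2 * n := by omega
    cases hk : w ⟨k, hkN⟩
    · obtain ⟨a, hia, hak, he⟩ := hclose ⟨k, hkN⟩ hik' hkj hk
      exact he ▸ ihk a (Nat.lt_succ_of_lt hak) hia (hak.le.trans (Nat.le_of_lt hkj))
    · have h1 := pathHeight_succ_of_true hk
      have h2 := ihk k (by omega) hik' (by omega)
      simp only at h1
      omega
  have habove' : ∀ k : ℕ, i.val < k → k ≤ j.val →
      pathHeight w (j + 1) < pathHeight w k := by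
    intro k hik hkj
    induction hd : j.val - k using Nat.strong_induction_on generalizing k with
    | _ d ihk =>
    subst hd
    rcases hkj.eq_or_lt with rfl | hkj'
    · omega
    have hkN : k < 2 * n := by omega
    cases hk : w ⟨k, hkN⟩
    · have h1 := pathHeight_succ_of_false hk
      have h2 := ihk _ (by omega) (k + 1) (by omega) hkj' rfl
      simp only at h1
      omega
    · obtain ⟨b, hkb, hbj, he⟩ := hopen ⟨k, hkN⟩ hik hkj' hk
      have hkb' : k < b.val := hkb
      exact he ▸ ihk _ (by omega) (b + 1) (by omega) hbj rfl
  have h1 := habove j hij le_rfl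
  have h2 := habove' (i + 1) (by omega) hij
  exact ⟨hij, by omega, habove⟩

open Classical in
/-- The set of all arcs of the lattice path of `w`. -/
noncomputable def arcMatching (w : Fin (2 * n) → Bool) : Finset (Finset (Fin (2 * n))) :=
  Finset.univ.filter fun p => ∃ i j, IsArc w i j ∧ p = {i, j}

lemma mem_arcMatching {p : Finset (Fin (2 * n))} :
    p ∈ arcMatching w ↔ ∃ i j, IsArc w i j ∧ p = {i, j} := by
  simp [arcMatching]

lemma isArc_of_pair_mem_arcMatching {i j : Fin (2 * n)} (hij : i < j)
    (h : {i, j} ∈ arcMatching w) : IsArc w i j := by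
  obtain ⟨a, b, hab, he⟩ := mem_arcMatching.1 h
  have hlt := hab.1
  have ha : a ∈ ({i, j} : Finset _) := he ▸ by simp
  have hb : b ∈ ({i, j} : Finset _) := he ▸ by simp
  simp only [Finset.mem_insert, Finset.mem_singleton] at ha hb
  rcases ha with rfl | rfl <;> rcases hb with rfl | rfl
  · exact absurd hlt (lt_irrefl _)
  · exact hab
  · exact absurd hlt hij.asymm
  · exact absurd hlt (lt_irrefl _)

lemma IsBallot.isPerfectMatching_arcMatching (hw : IsBallot n w) :
    IsPerfectMatching n (arcMatching w) := by
  refine ⟨fun p hp => ?_, fun i => ?_⟩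
  · obtain ⟨i, j, h, rfl⟩ := mem_arcMatching.1 hp
    exact Finset.card_pair h.1.ne
  cases hi : w i
  · obtain ⟨a, ha⟩ := exists_isArc_right hi (hw.pathHeight_nonneg i.2)
    refine ⟨{a, i}, ⟨mem_arcMatching.2 ⟨a, i, ha, rfl⟩, by simp⟩, ?_⟩
    rintro p ⟨hp, hip⟩
    obtain ⟨c, d, hcd, rfl⟩ := mem_arcMatching.1 hp
    simp only [Finset.mem_insert, Finset.mem_singleton] at hip
    rcases hip with rfl | rfl
    · simp [hcd.apply_left] at hi
    · rw [hcd.left_unique ha]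
  · obtain ⟨b, hb⟩ := exists_isArc_left hi
      (hw.pathHeight_end ▸ hw.pathHeight_nonneg i.2.le)
    refine ⟨{i, b}, ⟨mem_arcMatching.2 ⟨i, b, hb, rfl⟩, by simp⟩, ?_⟩
    rintro p ⟨hp, hip⟩
    obtain ⟨c, d, hcd, rfl⟩ := mem_arcMatching.1 hp
    simp only [Finset.mem_insert, Finset.mem_singleton] at hip
    rcases hip with rfl | rfl
    · rw [hcd.right_unique hb]
    · simp [hcd.apply_right] at hi

lemma isNoncrossing_arcMatching : IsNoncrossing n (arcMatching w) := by
  rintro ⟨i, k, j, l, hik, hkj, hjl, h, h'⟩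
  exact (isArc_of_pair_mem_arcMatching (hik.trans hkj) h).not_crossing
    (isArc_of_pair_mem_arcMatching (hkj.trans hjl) h') hik hkj hjl

end Matching

/-- For every ballot sequence `w` of length `2n`, there is a unique noncrossing perfect
matching of `Fin (2n)` all of whose pairs `{i, j}` with `i < j` satisfy `w i = true`
and `w j = false`. -/
theorem catalan_matching_existsUnique (n : ℕ) (w : Fin (2 * n) → Bool) (hw : IsBallot n w) :
    ∃! M : Finset (Finset (Fin (2 * n))),
      IsPerfectMatching n M ∧ IsNoncrossing n M ∧
        ∀ i j : Fin (2 * n), i < j → ({i, j} : Finset (Fin (2 * n))) ∈ M →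
          w i = true ∧ w j = false := by
  refine ⟨arcMatching w, ⟨hw.isPerfectMatching_arcMatching, isNoncrossing_arcMatching, ?_⟩, ?_⟩
  · intro i j hij h
    have harc := isArc_of_pair_mem_arcMatching hij h
    exact ⟨harc.apply_left, harc.apply_right⟩
  · rintro M ⟨hM, hnc, hlab⟩
    refine hM.eq_of_subset hw.isPerfectMatching_arcMatching fun p hp => ?_
    obtain ⟨a, b, hab, rfl⟩ := Finset.card_eq_two.1 (hM.1 p hp)
    rcases lt_or_gt_of_ne hab with h | h
    · exact mem_arcMatching.2 ⟨a, b, isArc_of_pair_mem hM hnc hlab h hp, rfl⟩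
    · rw [Finset.pair_comm] at hp ⊢
      exact mem_arcMatching.2 ⟨b, a, isArc_of_pair_mem hM hnc hlab h hp, rfl⟩
end

section
/- Let w be a ballot sequence of length 2n and let M be its Catalan matching. Then for indices i < j, the pair {i, j} belongs to M if and only if: w i = true, w j = false, for every k with i ≤ k < j the number of positions p with i ≤ p ≤ k and w p = true strictly exceeds the number of positions p with i ≤ p ≤ k and w p = false, and the number of positions p with i ≤ p ≤ j and w p = true equals the number of such positions with w p = false. -/
def IsCatalanMatching (n : ℕ) (w : Fin (2 * n) → Bool)
    (M : Finset (Finset (Fin (2 * n)))) : Prop :=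
  IsPerfectMatching n M ∧ IsNoncrossing n M ∧
    ∀ i j : Fin (2 * n), i < j → ({i, j} : Finset (Fin (2 * n))) ∈ M →
      w i = true ∧ w j = false

theorem IsPerfectMatching.exists_partner {n : ℕ} {M : Finset (Finset (Fin (2 * n)))}
    (hM : IsPerfectMatching n M) :
    ∃ σ : Fin (2 * n) → Fin (2 * n), Function.Involutive σ ∧ (∀ i, σ i ≠ i) ∧
      ∀ i j, i ≠ j → (({i, j} : Finset (Fin (2 * n))) ∈ M ↔ σ i = j) := by
  obtain ⟨hcard, huniq⟩ := hM
  have hex : ∀ i, ∃ j, j ≠ i ∧ ({i, j} : Finset (Fin (2 * n))) ∈ M := by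
    intro i
    obtain ⟨p, ⟨hp, hip⟩, -⟩ := huniq i
    obtain ⟨a, b, hab, rfl⟩ := Finset.card_eq_two.1 (hcard p hp)
    rcases Finset.mem_insert.1 hip with rfl | h
    · exact ⟨b, hab.symm, hp⟩
    · obtain rfl := Finset.mem_singleton.1 h
      exact ⟨a, hab, by rwa [Finset.pair_comm]⟩
  choose σ hne hmem using hex
  have hσ : ∀ i j, i ≠ j → ({i, j} : Finset (Fin (2 * n))) ∈ M → σ i = j := by
    intro i j hij h
    have he : ({i, σ i} : Finset (Fin (2 * n))) = {i, j} :=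
      (huniq i).unique ⟨hmem i, by simp⟩ ⟨h, by simp⟩
    have hj : σ i ∈ ({i, j} : Finset (Fin (2 * n))) := he ▸ by simp
    simpa [hne i] using hj
  refine ⟨σ, fun i => hσ _ _ (hne i) ?_, hne, fun i j hij => ⟨hσ i j hij, ?_⟩⟩
  · rw [Finset.pair_comm]
    exact hmem i
  · rintro rfl
    exact hmem i

/-- In a noncrossing involution, the interval between two partners is balanced, and each of its
proper initial segments contains more openers than closers. -/
theorem card_closers_lt_of_noncrossing {α : Type*} [LinearOrder α] [Fintype α]
    {w : α → Bool} {σ : α → α} (hinv : Function.Involutive σ)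
    (hw : ∀ p, w p = true ↔ p < σ p) (hw' : ∀ p, w p = false ↔ σ p < p)
    (hnc : ∀ i k, i < k → k < σ i → σ i < σ k → False) {i : α} (hi : i < σ i) :
    (∀ k, i ≤ k → k < σ i →
      (Finset.univ.filter fun p => i ≤ p ∧ p ≤ k ∧ w p = false).card <
        (Finset.univ.filter fun p => i ≤ p ∧ p ≤ k ∧ w p = true).card) ∧
    (Finset.univ.filter fun p => i ≤ p ∧ p ≤ σ i ∧ w p = true).card =
      (Finset.univ.filter fun p => i ≤ p ∧ p ≤ σ i ∧ w p = false).card := by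
  have hlow : ∀ p, i ≤ p → p ≤ σ i → i ≤ σ p := by
    intro p hip hpj
    by_contra! h
    have hp : i < p := lt_of_le_of_ne hip (by rintro rfl; exact absurd h hi.not_gt)
    have hp' : p < σ i := lt_of_le_of_ne hpj (by rintro rfl; simp [hinv i] at h)
    exact hnc (σ p) i h (by rwa [hinv p]) (by rwa [hinv p])
  have hupp : ∀ p, i ≤ p → p ≤ σ i → σ p ≤ σ i := by
    intro p hip hpj
    by_contra! h
    have hp : i < p := lt_of_le_of_ne hip (by rintro rfl; exact lt_irrefl _ h)
    have hp' : p < σ i := lt_of_le_of_ne hpj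
      (by rintro rfl; rw [hinv i] at h; exact absurd h hi.not_gt)
    exact hnc i p hp hp' h
  have hflip : ∀ p, w p = false → w (σ p) = true := fun p hp => by
    rw [hw, hinv p]
    exact (hw' p).1 hp
  have hflip' : ∀ p, w p = true → w (σ p) = false := fun p hp => by
    rw [hw', hinv p]
    exact (hw p).1 hp
  refine ⟨fun k hik hkj => ?_, ?_⟩
  · rw [← Finset.card_image_of_injective _ hinv.injective]
    refine Finset.card_lt_card ((Finset.ssubset_iff_of_subset ?_).2 ⟨i, ?_, ?_⟩)
    · intro q hq
      simp only [Finset.mem_image, Finset.mem_filter, Finset.mem_univ, true_and] at hq ⊢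
      obtain ⟨p, ⟨hip, hpk, hp⟩, rfl⟩ := hq
      exact ⟨hlow p hip (hpk.trans hkj.le), ((hw' p).1 hp).le.trans hpk, hflip p hp⟩
    · simp [hik, (hw i).2 hi]
    · simp only [Finset.mem_image, Finset.mem_filter, Finset.mem_univ, true_and]
      rintro ⟨p, ⟨-, hpk, -⟩, rfl⟩
      rw [hinv p] at hkj
      exact absurd hkj hpk.not_gt
  · refine Finset.card_bij' (fun p _ => σ p) (fun p _ => σ p) ?_ ?_
      (fun p _ => hinv p) (fun p _ => hinv p)
    all_goals
      intro p hp
      simp only [Finset.mem_filter, Finset.mem_univ, true_and] at hp ⊢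
    · exact ⟨hlow p hp.1 hp.2.1, hupp p hp.1 hp.2.1, hflip' p hp.2.2⟩
    · exact ⟨hlow p hp.1 hp.2.1, hupp p hp.1 hp.2.1, hflip p hp.2.2⟩

/-- Characterization of the pairs of the Catalan matching of a ballot sequence. -/
theorem catalan_matching_pair_iff (n : ℕ) (w : Fin (2 * n) → Bool)
    (M : Finset (Finset (Fin (2 * n)))) (hw : IsBallot n w)
    (hM : IsCatalanMatching n w M) :
    ∀ i j : Fin (2 * n), i < j →
      (({i, j} : Finset (Fin (2 * n))) ∈ M ↔
        w i = true ∧ w j = false ∧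
          (∀ k : Fin (2 * n), i ≤ k → k < j →
            (Finset.univ.filter fun p : Fin (2 * n) => i ≤ p ∧ p ≤ k ∧ w p = true).card >
              (Finset.univ.filter fun p : Fin (2 * n) => i ≤ p ∧ p ≤ k ∧ w p = false).card) ∧
          (Finset.univ.filter fun p : Fin (2 * n) => i ≤ p ∧ p ≤ j ∧ w p = true).card =
            (Finset.univ.filter fun p : Fin (2 * n) => i ≤ p ∧ p ≤ j ∧ w p = false).card) := by
  obtain ⟨hperf, hcross, hcol⟩ := hM
  obtain ⟨σ, hinv, hne, hσ⟩ := hperf.exists_partner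
  have hmem : ∀ p, ({p, σ p} : Finset (Fin (2 * n))) ∈ M := fun p => (hσ p _ (hne p).symm).2 rfl
  have hopen : ∀ p, p < σ p → w p = true := fun p hp => (hcol p _ hp (hmem p)).1
  have hclose : ∀ p, σ p < p → w p = false := fun p hp =>
    (hcol _ p hp (Finset.pair_comm p (σ p) ▸ hmem p)).2
  have hwt : ∀ p, w p = true ↔ p < σ p := fun p =>
    ⟨fun h => (hne p).lt_or_gt.resolve_left fun h' => by simp [hclose p h'] at h, hopen p⟩
  have hwf : ∀ p, w p = false ↔ σ p < p := fun p =>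
    ⟨fun h => (hne p).lt_or_gt.resolve_right fun h' => by simp [hopen p h'] at h, hclose p⟩
  have hnc : ∀ i k, i < k → k < σ i → σ i < σ k → False := fun i k h₁ h₂ h₃ =>
    hcross ⟨i, k, σ i, σ k, h₁, h₂, h₃, hmem i, hmem k⟩
  intro i j hij
  rw [hσ i j hij.ne]
  constructor
  · rintro rfl
    obtain ⟨hlt, heq⟩ := card_closers_lt_of_noncrossing hinv hwt hwf hnc hij
    exact ⟨(hwt i).2 hij, (hwf _).2 (by rwa [hinv i]), hlt, heq⟩
  · rintro ⟨hi, -, hlt', heq'⟩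
    have hi' := (hwt i).1 hi
    obtain ⟨hlt, heq⟩ := card_closers_lt_of_noncrossing hinv hwt hwf hnc hi'
    rcases lt_trichotomy (σ i) j with h | h | h
    · exact absurd heq (hlt' _ hi'.le h).ne'
    · exact h
    · exact absurd heq' (hlt j hij.le h).ne'
end

section
/- Let w be a ballot sequence of length 2n with Catalan matching M, and let w' be the reverse-complement of w. Then w' is a ballot sequence of length 2n, and the Catalan matching of w' is exactly the collection of pairs {2n − 1 − i, 2n − 1 − j} for {i, j} a pair of M. (This is the sl_2 case of the paper's main theorem: under the Catalan bijection, evacuation of 2-row rectangular standard Young tableaux corresponds to reflection of the associated noncrossing matching.) -/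
theorem card_filter_reverse_complement (n m : ℕ) (hm : m ≤ 2 * n) (w : Fin (2 * n) → Bool)
    (b : Bool) :
    (Finset.univ.filter fun i : Fin (2 * n) => i.val < m ∧ (! w i.rev) = b).card +
      (Finset.univ.filter fun i : Fin (2 * n) => i.val < 2 * n - m ∧ w i = !b).card =
      (Finset.univ.filter fun i : Fin (2 * n) => w i = !b).card := by
  have h : (Finset.univ.filter fun i : Fin (2 * n) => i.val < m ∧ (! w i.rev) = b).card =
      (Finset.univ.filter fun i : Fin (2 * n) => ¬ i.val < 2 * n - m ∧ w i = !b).card := by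
    refine Finset.card_equiv Fin.revPerm fun i => ?_
    have hi : i.val < m ↔ ¬ i.rev.val < 2 * n - m := by
      rw [Fin.val_rev]
      omega
    simp only [Finset.mem_filter, Finset.mem_univ, true_and, Fin.revPerm_apply, hi]
    cases w i.rev <;> cases b <;> simp
  rw [h, add_comm, ← Finset.card_filter_add_card_filter_not
    (s := Finset.univ.filter fun i : Fin (2 * n) => w i = !b) (fun i => i.val < 2 * n - m)]
  simp only [Finset.filter_filter, and_comm]

theorem IsBallot.reverse_complement {n : ℕ} {w : Fin (2 * n) → Bool} (hw : IsBallot n w) :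
    IsBallot n (fun i => ! w i.rev) := by
  obtain ⟨hcard, hle⟩ := hw
  have hfalse : (Finset.univ.filter fun i => w i = false).card = n := by
    have h := Finset.card_filter_add_card_filter_not
      (s := (Finset.univ : Finset (Fin (2 * n)))) (fun i => w i = true)
    simp only [Bool.not_eq_true, Finset.card_univ, Fintype.card_fin] at h
    omega
  refine ⟨?_, fun m hm => ?_⟩
  · have h := card_filter_reverse_complement n (2 * n) le_rfl w true
    simpa [hfalse] using h
  · have ht := card_filter_reverse_complement n m hm w true
    have hf := card_filter_reverse_complement n m hm w false
    have hk := hle (2 * n - m) (Nat.sub_le _ _)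
    simp only [Bool.not_true, Bool.not_false] at ht hf
    beta_reduce
    omega

theorem mem_image_image_rev {k : ℕ} {M : Finset (Finset (Fin k))} {p : Finset (Fin k)} :
    p ∈ M.image (Finset.image Fin.rev) ↔ p.image Fin.rev ∈ M := by
  have hinv (q : Finset (Fin k)) : (q.image Fin.rev).image Fin.rev = q := by
    simp [Finset.image_image, Fin.rev_involutive.comp_self]
  rw [Finset.mem_image]
  constructor
  · rintro ⟨q, hq, rfl⟩
    rwa [hinv]
  · exact fun hp => ⟨_, hp, hinv p⟩

theorem pair_mem_image_image_rev {k : ℕ} {M : Finset (Finset (Fin k))} {i j : Fin k} :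
    {i, j} ∈ M.image (Finset.image Fin.rev) ↔ {j.rev, i.rev} ∈ M := by
  rw [mem_image_image_rev, Finset.image_insert, Finset.image_singleton, Finset.pair_comm]

theorem IsPerfectMatching.image_rev {n : ℕ} {M : Finset (Finset (Fin (2 * n)))}
    (hM : IsPerfectMatching n M) : IsPerfectMatching n (M.image (Finset.image Fin.rev)) := by
  refine ⟨fun p hp => ?_, fun i => ?_⟩
  · exact (Finset.card_image_of_injective p Fin.rev_injective).symm.trans
      (hM.1 _ (mem_image_image_rev.1 hp))
  · obtain ⟨p, ⟨hp, hip⟩, huniq⟩ := hM.2 i.rev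
    refine ⟨p.image Fin.rev, ⟨Finset.mem_image_of_mem _ hp, ?_⟩, ?_⟩
    · simpa using Finset.mem_image_of_mem Fin.rev hip
    · rintro q ⟨hq, hiq⟩
      obtain ⟨r, hr, rfl⟩ := Finset.mem_image.1 hq
      obtain ⟨x, hx, rfl⟩ := Finset.mem_image.1 hiq
      rw [huniq r ⟨hr, by simpa using hx⟩]

theorem IsNoncrossing.image_rev {n : ℕ} {M : Finset (Finset (Fin (2 * n)))}
    (hM : IsNoncrossing n M) : IsNoncrossing n (M.image (Finset.image Fin.rev)) := by
  rintro ⟨i, k, j, l, hik, hkj, hjl, hij, hkl⟩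
  exact hM ⟨l.rev, j.rev, k.rev, i.rev, Fin.rev_lt_rev.2 hjl, Fin.rev_lt_rev.2 hkj,
    Fin.rev_lt_rev.2 hik, pair_mem_image_image_rev.1 hkl, pair_mem_image_image_rev.1 hij⟩

theorem IsCatalanMatching.reverse_complement {n : ℕ} {w : Fin (2 * n) → Bool}
    {M : Finset (Finset (Fin (2 * n)))} (hM : IsCatalanMatching n w M) :
    IsCatalanMatching n (fun i => ! w i.rev) (M.image (Finset.image Fin.rev)) := by
  refine ⟨hM.1.image_rev, hM.2.1.image_rev, fun i j hij h => ?_⟩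
  obtain ⟨hj, hi⟩ := hM.2.2 _ _ (Fin.rev_lt_rev.2 hij) (pair_mem_image_image_rev.1 h)
  simp [hi, hj]

/-- The `sl₂` case of the main theorem: the Catalan matching of the reverse-complement
of a ballot sequence is the reflection of the Catalan matching of the original
sequence. -/
theorem catalan_matching_reverse_complement (n : ℕ) (w : Fin (2 * n) → Bool)
    (M : Finset (Finset (Fin (2 * n)))) (hw : IsBallot n w)
    (hM : IsCatalanMatching n w M) :
    IsBallot n (fun i => ! w i.rev) ∧
      IsCatalanMatching n (fun i => ! w i.rev) (M.image (Finset.image Fin.rev)) := by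
  exact ⟨hw.reverse_complement, hM.reverse_complement⟩
end

section
/- Let w be a list over Fin n, and let w' be the list obtained by reversing w and replacing each letter x by n − 1 − x. Then for every i, the Greene–Kleitman invariant Δ_i(w') equals Δ_i(w). -/
/-- `u` is a `d_i`-subword of `w`: it is a subword of `w` that can be partitioned into
at most `i` pairwise disjoint nondecreasing subwords. -/
def IsDSubword {α : Type*} [LinearOrder α] (i : ℕ) (u w : List α) : Prop :=
  u.Sublist w ∧ ∃ c : Fin u.length → Fin i,
    ∀ p q : Fin u.length, p < q → c p = c q → u.get p ≤ u.get q

/-- The Greene–Kleitman invariant `Δ_i(w)`: the maximum length of a `d_i`-subword. -/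
noncomputable def greeneKleitman {α : Type*} [LinearOrder α] (i : ℕ) (w : List α) : ℕ :=
  sSup {L : ℕ | ∃ u : List α, IsDSubword i u w ∧ u.length = L}

/-- An antitone relabelling of the letters followed by reversal of the word preserves
`d_i`-subwords. -/
theorem IsDSubword.reverse_map {α β : Type*} [LinearOrder α] [LinearOrder β] {f : α → β}
    (hf : Antitone f) {i : ℕ} {u w : List α} (h : IsDSubword i u w) :
    IsDSubword i (u.map f).reverse (w.map f).reverse := by
  obtain ⟨hs, c, hc⟩ := h
  have hlen : (u.map f).reverse.length = u.length := by simp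
  refine ⟨(hs.map f).reverse, fun p => c (p.cast hlen).rev, fun p q hpq hcpq => ?_⟩
  have hle := hf (hc (q.cast hlen).rev (p.cast hlen).rev (Fin.rev_lt_rev.2 hpq) hcpq.symm)
  simpa [Fin.val_rev, Nat.sub_sub, Nat.add_comm] using hle

/-- The Greene–Kleitman invariants are preserved under simultaneously reversing the word
and reversing the alphabet. -/
theorem greeneKleitman_reverse_complement (n : ℕ) (w : List (Fin n)) (i : ℕ) :
    greeneKleitman i (w.map Fin.rev).reverse = greeneKleitman i w := by
  have hinv : ∀ v : List (Fin n), (((v.map Fin.rev).reverse).map Fin.rev).reverse = v := by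
    simp [Function.comp_def]
  have hanti : Antitone (Fin.rev : Fin n → Fin n) := fun _ _ h => Fin.rev_le_rev.2 h
  unfold greeneKleitman
  congr 1
  ext L
  constructor
  · rintro ⟨u, hu, rfl⟩
    have hu' := hu.reverse_map hanti
    rw [hinv] at hu'
    exact ⟨_, hu', by simp⟩
  · rintro ⟨u, hu, rfl⟩
    exact ⟨_, hu.reverse_map hanti, by simp⟩
end

section
/- Let w be a 3-row lattice word of length 3k and let a ∈ {0, 1}. List in increasing order the 2k positions p with w p ∈ {a, a+1}, and define u : Fin (2k) → Bool by letting u j = true if and only if the j-th such position p satisfies w p = a. Then u is a ballot sequence of length 2k. -/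
/-- A 3-row lattice word of length `3k`: each of the letters `0, 1, 2` occurs exactly
`k` times, and in every prefix the letter `a` occurs at least as often as `a + 1` for
`a ∈ {0, 1}`. -/
def IsLattice3 (k : ℕ) (w : Fin (3 * k) → Fin 3) : Prop :=
  (∀ a : Fin 3, (Finset.univ.filter fun i => w i = a).card = k) ∧
    ∀ m : ℕ, m ≤ 3 * k → ∀ a : ℕ, a < 2 →
      (Finset.univ.filter fun i : Fin (3 * k) => i.val < m ∧ (w i).val = a).card ≥
        (Finset.univ.filter fun i : Fin (3 * k) => i.val < m ∧ (w i).val = a + 1).card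

theorem StrictMono.exists_lt_iff_val_lt {n N : ℕ} {e : Fin n → Fin N} (he : StrictMono e)
    (m : ℕ) : ∃ M ≤ N, ∀ j : Fin n, j.val < m ↔ (e j).val < M := by
  by_cases hm : m < n
  · exact ⟨e ⟨m, hm⟩, (e ⟨m, hm⟩).isLt.le, fun j => (he.lt_iff_lt (a := j) (b := ⟨m, hm⟩)).symm⟩
  · exact ⟨N, le_rfl, fun j => iff_of_true (by omega) (e j).isLt⟩

theorem Finset.card_filter_comp_of_injective {α β : Type*} [Fintype α] [Fintype β]
    {e : α → β} (he : Function.Injective e) (P : β → Prop) [DecidablePred P]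
    (hP : ∀ p, P p → ∃ j, e j = p) :
    (Finset.univ.filter fun j => P (e j)).card = (Finset.univ.filter P).card := by
  refine Finset.card_bij (fun j _ => e j) (by simp) (fun _ _ _ _ h => he h) fun p hp => ?_
  obtain ⟨j, rfl⟩ := hP p (Finset.mem_filter.1 hp).2
  exact ⟨j, by simpa using hp, rfl⟩

/-- Restricting a 3-row lattice word to the positions carrying letters `a` and `a + 1`
(for `a ∈ {0, 1}`), with letter `a` playing the role of `true`, gives a ballot
sequence. -/
theorem lattice3_two_rows_ballot (k : ℕ) (w : Fin (3 * k) → Fin 3)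
    (hw : IsLattice3 k w) (a : ℕ) (ha : a < 2)
    (e : Fin (2 * k) → Fin (3 * k)) (he : StrictMono e)
    (hrange : ∀ p : Fin (3 * k), (∃ j, e j = p) ↔ (w p).val = a ∨ (w p).val = a + 1) :
    IsBallot k (fun j => decide ((w (e j)).val = a)) := by
  have succ_iff (j : Fin (2 * k)) : (w (e j)).val ≠ a ↔ (w (e j)).val = a + 1 := by
    have := (hrange (e j)).1 ⟨j, rfl⟩
    omega
  refine ⟨?_, fun m _ => ?_⟩
  · simp only [decide_eq_true_eq]
    rw [Finset.card_filter_comp_of_injective he.injective (fun p => (w p).val = a)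
      fun p hp => (hrange p).2 (Or.inl hp)]
    simpa only [Fin.ext_iff] using hw.1 ⟨a, by omega⟩
  · obtain ⟨M, hM, hlt⟩ := he.exists_lt_iff_val_lt m
    simp only [decide_eq_true_eq, decide_eq_false_iff_not, succ_iff, hlt]
    rw [Finset.card_filter_comp_of_injective he.injective
        (fun p => p.val < M ∧ (w p).val = a) fun p hp => (hrange p).2 (Or.inl hp.2),
      Finset.card_filter_comp_of_injective he.injective
        (fun p => p.val < M ∧ (w p).val = a + 1) fun p hp => (hrange p).2 (Or.inr hp.2)]
    exact hw.2 M hM a ha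
end

section
/- Let w be a 3-row lattice word of length 3k and let w' be its reverse-complement, w' i = 2 − w (3k − 1 − i). For a ∈ {0, 1}, let P_a(w) denote the row-(a, a+1) pairing of w: the set of pairs of positions of Fin (3k) obtained by transporting the Catalan matching of the ballot sequence formed by the positions of w carrying letters a and a+1 (letter a playing the role of true) back to those positions. Then P_0(w') is exactly the collection of pairs {3k − 1 − i, 3k − 1 − j} for {i, j} a pair of P_1(w), and P_1(w') is exactly the collection of pairs {3k − 1 − i, 3k − 1 − j} for {i, j} a pair of P_0(w). (This is the combinatorial core of the sl_3 case of the paper's main theorem: the m-diagram of the evacuation of a 3×k standard Young tableau is the reflection of the m-diagram of the original tableau.) -/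
/-- `P` is the row-`(a, a+1)` pairing of the 3-row lattice word `w`: transporting the
Catalan matching of the ballot sequence formed by the positions carrying letters `a`
and `a + 1` (letter `a` playing the role of `true`) back to those positions. -/
def IsRowPairing (k : ℕ) (w : Fin (3 * k) → Fin 3) (a : ℕ)
    (P : Finset (Finset (Fin (3 * k)))) : Prop :=
  ∃ e : Fin (2 * k) → Fin (3 * k), StrictMono e ∧
    (∀ p : Fin (3 * k), (∃ j, e j = p) ↔ (w p).val = a ∨ (w p).val = a + 1) ∧
    ∃ M : Finset (Finset (Fin (2 * k))),
      IsCatalanMatching k (fun j => decide ((w (e j)).val = a)) M ∧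
        P = M.image (Finset.image e)

namespace IsCatalanMatching

variable {n : ℕ} {u : Fin (2 * n) → Bool} {M N : Finset (Finset (Fin (2 * n)))}

theorem right_unique (h : IsCatalanMatching n u M) {i j j' : Fin (2 * n)}
    (hj : {i, j} ∈ M) (hj' : {i, j'} ∈ M) : j = j' := by
  have hs : ({i, j} : Finset (Fin (2 * n))) = {i, j'} :=
    (h.1.2 i).unique ⟨hj, by simp⟩ ⟨hj', by simp⟩
  have hc := h.1.1 _ hj
  have hne : i ≠ j := by
    rintro rfl
    simp at hc
  have hmem : j ∈ ({i, j'} : Finset (Fin (2 * n))) := hs ▸ by simp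
  simp only [Finset.mem_insert, Finset.mem_singleton] at hmem
  exact hmem.resolve_left hne.symm

theorem left_unique (h : IsCatalanMatching n u M) {i i' j : Fin (2 * n)}
    (hi : {i, j} ∈ M) (hi' : {i', j} ∈ M) : i = i' := by
  rw [Finset.pair_comm] at hi hi'
  exact h.right_unique hi hi'

theorem exists_partner (h : IsCatalanMatching n u M) (i : Fin (2 * n)) :
    ∃ j, j ≠ i ∧ {i, j} ∈ M := by
  obtain ⟨p, ⟨hp, hi⟩, -⟩ := h.1.2 i
  obtain ⟨x, y, hxy, rfl⟩ := Finset.card_eq_two.1 (h.1.1 p hp)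
  simp only [Finset.mem_insert, Finset.mem_singleton] at hi
  rcases hi with rfl | rfl
  · exact ⟨y, hxy.symm, hp⟩
  · exact ⟨x, hxy, Finset.pair_comm x i ▸ hp⟩

theorem exists_right (h : IsCatalanMatching n u M) {i : Fin (2 * n)} (hi : u i = true) :
    ∃ j, i < j ∧ {i, j} ∈ M := by
  obtain ⟨j, hne, hj⟩ := h.exists_partner i
  rcases lt_or_gt_of_ne hne with hlt | hlt
  · rw [Finset.pair_comm] at hj
    simp [(h.2.2 j i hlt hj).2] at hi
  · exact ⟨j, hlt, hj⟩

theorem exists_left (h : IsCatalanMatching n u M) {j : Fin (2 * n)} (hj : u j = false) :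
    ∃ i, i < j ∧ {i, j} ∈ M := by
  obtain ⟨i, hne, hi⟩ := h.exists_partner j
  rcases lt_or_gt_of_ne hne with hlt | hlt
  · exact ⟨i, hlt, Finset.pair_comm j i ▸ hi⟩
  · simp [(h.2.2 j i hlt hi).1] at hj

theorem pair_mem_of_pair_mem (hM : IsCatalanMatching n u M) (hN : IsCatalanMatching n u N)
    {i j : Fin (2 * n)} (hij : i < j) (h : {i, j} ∈ M) : {i, j} ∈ N := by
  induction hd : j.val - i.val using Nat.strong_induction_on generalizing i j with
  | _ d ih =>
  obtain ⟨hui, huj⟩ := hM.2.2 i j hij h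
  obtain ⟨b, hib, hb⟩ := hN.exists_right hui
  rcases lt_trichotomy b j with hbj | rfl | hjb
  · obtain ⟨c, hcb, hc⟩ := hM.exists_left (hN.2.2 i b hib hb).2
    rcases lt_trichotomy c i with hci | rfl | hic
    · exact (hM.2.1 ⟨c, i, b, j, hci, hib, hbj, hc, h⟩).elim
    · exact absurd (hM.right_unique h hc) hbj.ne'
    · exact absurd (hN.left_unique hb (ih _ (by omega) hcb hc rfl)) hic.ne
  · exact hb
  · obtain ⟨a, haj, ha⟩ := hN.exists_left huj
    rcases lt_trichotomy a i with hai | rfl | hia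
    · exact (hN.2.1 ⟨a, i, j, b, hai, hij, hjb, ha, hb⟩).elim
    · exact ha
    · obtain ⟨c, hac, hc⟩ := hM.exists_right (hN.2.2 a j haj ha).1
      rcases lt_trichotomy c j with hcj | rfl | hjc
      · exact absurd (hN.right_unique ha (ih _ (by omega) hac hc rfl)) hcj.ne'
      · exact absurd (hM.left_unique h hc) hia.ne
      · exact (hM.2.1 ⟨i, a, j, c, hia, haj, hjc, h, hc⟩).elim

theorem subset (hM : IsCatalanMatching n u M) (hN : IsCatalanMatching n u N) : M ⊆ N := by
  intro p hp
  obtain ⟨x, y, hxy, rfl⟩ := Finset.card_eq_two.1 (hM.1.1 p hp)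
  rcases lt_or_gt_of_ne hxy with hlt | hlt
  · exact hM.pair_mem_of_pair_mem hN hlt hp
  · rw [Finset.pair_comm] at hp ⊢
    exact hM.pair_mem_of_pair_mem hN hlt hp

theorem eq (hM : IsCatalanMatching n u M) (hN : IsCatalanMatching n u N) : M = N :=
  (hM.subset hN).antisymm (hN.subset hM)

theorem mem_image_rev {p : Finset (Fin (2 * n))} :
    p ∈ M.image (Finset.image Fin.rev) ↔ p.image Fin.rev ∈ M := by
  have hinv (q : Finset (Fin (2 * n))) : (q.image Fin.rev).image Fin.rev = q := by
    simp [Finset.image_image, Fin.rev_involutive.comp_self]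
  rw [Finset.mem_image]
  constructor
  · rintro ⟨q, hq, rfl⟩
    rwa [hinv]
  · exact fun hp => ⟨_, hp, hinv p⟩

/-- Reflecting a Catalan matching gives the Catalan matching of the reversed and complemented
sequence. -/
theorem image_rev (h : IsCatalanMatching n u M) :
    IsCatalanMatching n (fun j => !u j.rev) (M.image (Finset.image Fin.rev)) := by
  refine ⟨⟨fun p hp => ?_, fun i => ?_⟩, ?_, fun i j hij hp => ?_⟩
  · obtain ⟨q, hq, rfl⟩ := Finset.mem_image.1 hp
    rw [Finset.card_image_of_injective _ Fin.rev_injective, h.1.1 q hq]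
  · obtain ⟨q, ⟨hq, hi⟩, huniq⟩ := h.1.2 i.rev
    refine ⟨q.image Fin.rev, ⟨Finset.mem_image_of_mem _ hq, ?_⟩, ?_⟩
    · exact Finset.mem_image.2 ⟨i.rev, hi, Fin.rev_rev i⟩
    · rintro p ⟨hp, hip⟩
      obtain ⟨r, hr, rfl⟩ := Finset.mem_image.1 hp
      obtain ⟨x, hx, rfl⟩ := Finset.mem_image.1 hip
      rw [huniq r ⟨hr, by simpa using hx⟩]
  · rintro ⟨i, k, j, l, hik, hkj, hjl, hij, hkl⟩
    rw [mem_image_rev, Finset.image_insert, Finset.image_singleton, Finset.pair_comm] at hij hkl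
    exact h.2.1 ⟨l.rev, j.rev, k.rev, i.rev, Fin.rev_lt_rev.2 hjl, Fin.rev_lt_rev.2 hkj,
      Fin.rev_lt_rev.2 hik, hkl, hij⟩
  · rw [mem_image_rev, Finset.image_insert, Finset.image_singleton, Finset.pair_comm] at hp
    have := h.2.2 _ _ (Fin.rev_lt_rev.2 hij) hp
    simp [this.1, this.2]

end IsCatalanMatching

theorem IsRowPairing.eq_image_rev {k : ℕ} {w : Fin (3 * k) → Fin 3} {a b : ℕ} (hab : a + b = 1)
    {P Q : Finset (Finset (Fin (3 * k)))} (hP : IsRowPairing k w a P)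
    (hQ : IsRowPairing k (fun i => (w i.rev).rev) b Q) :
    Q = P.image (Finset.image Fin.rev) := by
  obtain ⟨e, he, hre, M, hM, rfl⟩ := hP
  obtain ⟨f, hf, hrf, N, hN, rfl⟩ := hQ
  have hfe : f = fun j => (e j.rev).rev := by
    refine (hf.range_inj fun i j hij => Fin.rev_lt_rev.2 (he (Fin.rev_lt_rev.2 hij))).1 ?_
    ext p
    have hp : (∃ j : Fin (2 * k), (e j.rev).rev = p) ↔ ∃ j, e j = p.rev :=
      ⟨fun ⟨j, hj⟩ => ⟨j.rev, by rw [← hj, Fin.rev_rev]⟩,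
        fun ⟨j, hj⟩ => ⟨j.rev, by rw [Fin.rev_rev, hj, Fin.rev_rev]⟩⟩
    simp only [Set.mem_range]
    rw [hp, hre, hrf, Fin.val_rev]
    omega
  subst hfe
  have hu : (fun j : Fin (2 * k) => decide (((w (e j.rev).rev.rev).rev).val = b)) =
      fun j => !decide ((w (e j.rev)).val = a) := by
    funext j
    have := (hre (e j.rev)).1 ⟨_, rfl⟩
    rw [← decide_not, decide_eq_decide, Fin.rev_rev, Fin.val_rev]
    omega
  have hN' : IsCatalanMatching k (fun j => !decide ((w (e j.rev)).val = a)) N := hu ▸ hN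
  rw [hN'.eq hM.image_rev, Finset.image_image, Finset.image_image]
  congr 1
  funext p
  simp [Finset.image_image, Function.comp_def]

/-- The combinatorial core of the `sl₃` case of the main theorem: the row pairings of
the reverse-complement of a 3-row lattice word are the reflections of the (swapped) row
pairings of the original word. -/
theorem rowPairing_reverse_complement (k : ℕ) (w : Fin (3 * k) → Fin 3)
    (hw : IsLattice3 k w) (P0 P1 Q0 Q1 : Finset (Finset (Fin (3 * k))))
    (h0 : IsRowPairing k w 0 P0) (h1 : IsRowPairing k w 1 P1)
    (h0' : IsRowPairing k (fun i => (w i.rev).rev) 0 Q0)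
    (h1' : IsRowPairing k (fun i => (w i.rev).rev) 1 Q1) :
    Q0 = P1.image (Finset.image Fin.rev) ∧ Q1 = P0.image (Finset.image Fin.rev) :=
  ⟨h1.eq_image_rev rfl h0', h0.eq_image_rev rfl h1'⟩
end
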